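/- Let d ∈ ℕ with d ≥ 2 and let p¹,…,p^d be probability kernels on [0,1] such that for every k ∈ {1,…,d}, every m' ∈ {0,1,2}, and every φ ∈ C^{m'}([0,1],ℝ) the function z ↦ ∫ φ(y) p^k(z,dy) belongs to C^{m'}([0,1],ℝ) and satisfies ‖z ↦ ∫ φ(y) p^k(z,dy)‖_{C^{m'}} ≤ ‖φ‖_{C^{m'}} for m' ∈ {0,1} and ≤ c ‖φ‖_{C^{m'}} for m' = 2, where c ∈ [1,∞). Define (T²f)(x) := ∫ f(y) ⊗_{k=1}^d p^k(x_k,dy_k). Then for every f ∈ C²([0,1]^d,ℝ), every i, j ∈ {1,…,d} with i ≠ j, and every x ∈ [0,1]^d it holds that |(∂²/∂x_i∂x_j)(T²f)(x)| ≤ max_{k,l ∈ {0,1}} ‖∂^{k+l} f/(∂x_i^k ∂x_j^l)‖_∞. -/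

import Mathlib

open MeasureTheory Filter

noncomputable section

/-- The unit cube `[0,1]^d` in `ℝ^d`. -/
def cube (d : ℕ) : Set (Fin d → ℝ) := Set.univ.pi fun _ => Set.Icc (0:ℝ) 1

/-- Partial derivative in coordinate `i` (within `[0,1]`, i.e. one-sided at the boundary). -/
def pd (d : ℕ) (i : Fin d) (g : (Fin d → ℝ) → ℝ) : (Fin d → ℝ) → ℝ :=
  fun x => derivWithin (fun t => g (Function.update x i t)) (Set.Icc (0:ℝ) 1) (x i)

/-- Iterated partial derivative `∂^α` (coordinates applied in a fixed order). -/
def mderiv (d : ℕ) (α : Fin d → ℕ) (f : (Fin d → ℝ) → ℝ) : (Fin d → ℝ) → ℝ :=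
  List.foldr (fun i g => (pd d i)^[α i] g) f (List.finRange d)

/-- `f ∈ C^m([0,1]^d, ℝ)`: all partial derivatives of order `0` through `m` exist
(one-sidedly at the boundary) and are continuous on the cube. -/
def MemCm (d : ℕ) : ℕ → ((Fin d → ℝ) → ℝ) → Prop
  | 0, f => ContinuousOn f (cube d)
  | m + 1, f => ContinuousOn f (cube d) ∧ ∀ i : Fin d,
      (∀ x ∈ cube d, DifferentiableWithinAt ℝ (fun t => f (Function.update x i t))
        (Set.Icc (0:ℝ) 1) (x i)) ∧
      MemCm d m (pd d i f)

/-- Sup norm over the cube: `‖g‖_∞ = sup_{x ∈ [0,1]^d} |g(x)|`. -/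
def supCube (d : ℕ) (g : (Fin d → ℝ) → ℝ) : ℝ := ⨆ x : cube d, |g x.1|

/-- The `C^m`-norm: `max_{|α| ≤ m} sup_{x ∈ [0,1]^d} |∂^α f(x)|`. -/
def CmNorm (d m : ℕ) (f : (Fin d → ℝ) → ℝ) : ℝ :=
  ⨆ α : {α : Fin d → ℕ // (∑ i, α i) ≤ m}, supCube d (mderiv d α.1 f)

/-- `λ_m := max_{0 < |α| ≤ m} ∑_i ‖∂^α b_i‖_∞`. -/
def lamNorm (d m : ℕ) (b : Fin d → (Fin d → ℝ) → ℝ) : ℝ :=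
  ⨆ α : {α : Fin d → ℕ // 0 < (∑ i, α i) ∧ (∑ i, α i) ≤ m},
    ∑ i, supCube d (mderiv d α.1 (b i))

/-- One-sided derivative within `[0,1]` for a one-dimensional function. -/
noncomputable def dI (φ : ℝ → ℝ) : ℝ → ℝ := fun z => derivWithin φ (Set.Icc (0:ℝ) 1) z

/-- `φ ∈ C^m([0,1], ℝ)`: derivatives of order `0` through `m` exist
(one-sidedly at the boundary) and are continuous on `[0,1]`. -/
def MemC1d : ℕ → (ℝ → ℝ) → Prop
  | 0, φ => ContinuousOn φ (Set.Icc (0:ℝ) 1)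
  | m + 1, φ => ContinuousOn φ (Set.Icc (0:ℝ) 1) ∧
      (∀ z ∈ Set.Icc (0:ℝ) 1, DifferentiableWithinAt ℝ φ (Set.Icc (0:ℝ) 1) z) ∧
      MemC1d m (dI φ)

/-- The `C^m`-norm of a one-dimensional function: `max_{k ≤ m} sup_{z ∈ [0,1]} |φ^{(k)}(z)|`. -/
noncomputable def C1dNorm (m : ℕ) (φ : ℝ → ℝ) : ℝ :=
  ⨆ k : Fin (m + 1), ⨆ z : Set.Icc (0:ℝ) 1, |dI^[(k : ℕ)] φ z.1|

/-- `PEC d [i₁, …, i_n] g` means: the successive partial derivatives of `g` in the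
coordinates `i₁, …, i_n` (in this order, one-sided at the boundary) exist at every point
of the cube, and the final `n`-th order partial derivative is continuous on the cube. -/
def PEC (d : ℕ) : List (Fin d) → ((Fin d → ℝ) → ℝ) → Prop
  | [], g => ContinuousOn g (cube d)
  | i :: L, g => (∀ x ∈ cube d, DifferentiableWithinAt ℝ
      (fun t => g (Function.update x i t)) (Set.Icc (0:ℝ) 1) (x i)) ∧
      PEC d L (pd d i g)

/-- Differentiation under the integral sign at a point of a set, for Lipschitz integrands. -/
theorem hasDerivWithinAt_integral_of_lipschitz {Ω : Type*} [MeasurableSpace Ω] {μ : Measure Ω}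
    [IsFiniteMeasure μ] {F : ℝ → Ω → ℝ} {F' : Ω → ℝ} {I : Set ℝ} {b M : ℝ} (hb : b ∈ I)
    (hint : ∀ z ∈ I, Integrable (F z) μ)
    (hlip : ∀ᵐ ω ∂μ, ∀ z ∈ I, |F z ω - F b ω| ≤ M * |z - b|)
    (hderiv : ∀ᵐ ω ∂μ, HasDerivWithinAt (fun z => F z ω) (F' ω) I b) :
    HasDerivWithinAt (fun z => ∫ ω, F z ω ∂μ) (∫ ω, F' ω ∂μ) I b := by
  rw [hasDerivWithinAt_iff_tendsto_slope]
  have hself : ∀ᶠ z in nhdsWithin b (I \ {b}), z ∈ I \ {b} := self_mem_nhdsWithin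
  have key : Tendsto (fun z => ∫ ω, (z - b)⁻¹ * (F z ω - F b ω) ∂μ)
      (nhdsWithin b (I \ {b})) (nhds (∫ ω, F' ω ∂μ)) := by
    refine tendsto_integral_filter_of_dominated_convergence (fun _ => M) ?_ ?_
      (integrable_const M) ?_
    · filter_upwards [hself] with z hz
      exact (((hint z hz.1).sub (hint b hb)).const_mul _).aestronglyMeasurable
    · filter_upwards [hself] with z hz
      filter_upwards [hlip] with ω hω
      have hpos : 0 < |z - b| := abs_pos.2 (sub_ne_zero.2 hz.2)
      rw [Real.norm_eq_abs, abs_mul, abs_inv, inv_mul_le_iff₀ hpos, mul_comm]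
      exact hω z hz.1
    · filter_upwards [hderiv] with ω hω
      rw [hasDerivWithinAt_iff_tendsto_slope] at hω
      refine hω.congr fun z => ?_
      simp [slope_def_module]
  refine key.congr' ?_
  filter_upwards [hself] with z hz
  rw [integral_const_mul, integral_sub (hint z hz.1) (hint b hb)]
  simp [slope_def_module]

/-- A family of measures acts contractively on `C¹([0,1])`. -/
def ContractsC1 (q : ℝ → Measure ℝ) : Prop :=
  ∀ (ψ ψ' : ℝ → ℝ) (M : ℝ), ContinuousOn ψ' (Set.Icc 0 1) →
    (∀ z ∈ Set.Icc (0:ℝ) 1, HasDerivWithinAt ψ (ψ' z) (Set.Icc 0 1) z) →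
    (∀ z ∈ Set.Icc (0:ℝ) 1, |ψ z| ≤ M) → (∀ z ∈ Set.Icc (0:ℝ) 1, |ψ' z| ≤ M) →
    ∀ z ∈ Set.Icc (0:ℝ) 1,
      DifferentiableWithinAt ℝ (fun z => ∫ y, ψ y ∂ q z) (Set.Icc 0 1) z ∧
      |derivWithin (fun z => ∫ y, ψ y ∂ q z) (Set.Icc 0 1) z| ≤ M

theorem C1dNorm_one_le {φ : ℝ → ℝ} {M : ℝ} (h0 : ∀ z ∈ Set.Icc (0:ℝ) 1, |φ z| ≤ M)
    (h1 : ∀ z ∈ Set.Icc (0:ℝ) 1, |dI φ z| ≤ M) : C1dNorm 1 φ ≤ M := by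
  have : Nonempty (Set.Icc (0:ℝ) 1) := ⟨⟨0, by simp⟩⟩
  refine ciSup_le fun k => ciSup_le fun z => ?_
  fin_cases k
  · exact h0 z z.2
  · exact h1 z z.2

theorem abs_dI_le_C1dNorm_one {φ : ℝ → ℝ} (hφ : MemC1d 1 φ) {z : ℝ}
    (hz : z ∈ Set.Icc (0:ℝ) 1) : |dI φ z| ≤ C1dNorm 1 φ := by
  have hcont : ContinuousOn (dI φ) (Set.Icc 0 1) := hφ.2.2
  have hbdd : BddAbove (Set.range fun z : Set.Icc (0:ℝ) 1 => |dI φ z|) := by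
    have h := (isCompact_Icc (a := (0:ℝ)) (b := 1)).bddAbove_image hcont.abs
    rwa [Set.image_eq_range] at h
  refine (le_ciSup hbdd ⟨z, hz⟩).trans ?_
  exact le_ciSup (f := fun k : Fin 2 => ⨆ z : Set.Icc (0:ℝ) 1, |dI^[(k : ℕ)] φ z.1|)
    (Set.finite_range _).bddAbove 1

theorem contractsC1_of_C1dNorm_le {q : ℝ → Measure ℝ}
    (hq : ∀ φ : ℝ → ℝ, MemC1d 1 φ → MemC1d 1 (fun z => ∫ y, φ y ∂ q z) ∧
      C1dNorm 1 (fun z => ∫ y, φ y ∂ q z) ≤ C1dNorm 1 φ) : ContractsC1 q := by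
  intro ψ ψ' M hc hd h0 h1 z hz
  have hdI : ∀ z ∈ Set.Icc (0:ℝ) 1, dI ψ z = ψ' z := fun z hz =>
    (hd z hz).derivWithin (uniqueDiffOn_Icc zero_lt_one z hz)
  have hmem : MemC1d 1 ψ := ⟨fun z hz => (hd z hz).continuousWithinAt,
    fun z hz => (hd z hz).differentiableWithinAt, hc.congr hdI⟩
  obtain ⟨hP, hle⟩ := hq ψ hmem
  refine ⟨hP.2.1 z hz, (abs_dI_le_C1dNorm_one hP hz).trans (hle.trans ?_)⟩
  exact C1dNorm_one_le h0 fun z hz => (hdI z hz).symm ▸ h1 z hz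

/-- Equality of mixed partial derivatives on the unit square. -/
theorem hasDerivWithinAt_of_mixed {A B C D : ℝ → ℝ → ℝ} (hB : Continuous (Function.uncurry B))
    (hD : Continuous (Function.uncurry D))
    (hAB : ∀ s ∈ Set.Icc (0:ℝ) 1, ∀ t ∈ Set.Icc (0:ℝ) 1,
      HasDerivWithinAt (A s) (B s t) (Set.Icc 0 1) t)
    (hAC : ∀ s ∈ Set.Icc (0:ℝ) 1, ∀ t ∈ Set.Icc (0:ℝ) 1,
      HasDerivWithinAt (fun s => A s t) (C s t) (Set.Icc 0 1) s)
    (hBD : ∀ s ∈ Set.Icc (0:ℝ) 1, ∀ t ∈ Set.Icc (0:ℝ) 1,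
      HasDerivWithinAt (fun s => B s t) (D s t) (Set.Icc 0 1) s)
    {s t : ℝ} (hs : s ∈ Set.Icc (0:ℝ) 1) (ht : t ∈ Set.Icc (0:ℝ) 1) :
    HasDerivWithinAt (C s) (D s t) (Set.Icc 0 1) t := by
  have ftc : ∀ {g g' : ℝ → ℝ}, Continuous g' →
      (∀ z ∈ Set.Icc (0:ℝ) 1, HasDerivWithinAt g (g' z) (Set.Icc 0 1) z) →
      ∀ z ∈ Set.Icc (0:ℝ) 1, ∫ y in (0:ℝ)..z, g' y = g z - g 0 := by
    intro g g' hg' hd z hz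
    refine intervalIntegral.integral_eq_sub_of_hasDerivAt_of_le hz.1 (fun y hy =>
      (hd y ⟨hy.1, hy.2.trans hz.2⟩).continuousWithinAt.mono
        (Set.Icc_subset_Icc_right hz.2)) (fun y hy => ?_) (hg'.intervalIntegrable _ _)
    exact (hd y ⟨hy.1.le, hy.2.le.trans hz.2⟩).hasDerivAt
      (Icc_mem_nhds hy.1 (hy.2.trans_le hz.2))
  have zero_mem : (0:ℝ) ∈ Set.Icc (0:ℝ) 1 := by simp
  have hDt : ∀ s, Continuous (D s) := fun s => hD.comp (Continuous.prodMk_right s)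
  have hDs : ∀ t, Continuous (fun s => D s t) := fun t => hD.comp (Continuous.prodMk_left t)
  have hBt : ∀ s, Continuous (B s) := fun s => hB.comp (Continuous.prodMk_right s)
  have hcont : ∀ t, Continuous fun s => ∫ y in (0:ℝ)..t, D s y := fun t =>
    intervalIntegral.continuous_parametric_intervalIntegral_of_continuous' hD 0 t
  have hA : ∀ s ∈ Set.Icc (0:ℝ) 1, ∀ t ∈ Set.Icc (0:ℝ) 1,
      A s t = A s 0 + (A 0 t - A 0 0) + ∫ σ in (0:ℝ)..s, ∫ τ in (0:ℝ)..t, D σ τ := by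
    intro s hs t ht
    have h1 := ftc (hBt s) (hAB s hs) t ht
    have h2 := ftc (hBt 0) (hAB 0 zero_mem) t ht
    have h3 : ∫ τ in (0:ℝ)..t, (B s τ - B 0 τ) = ∫ τ in (0:ℝ)..t, ∫ σ in (0:ℝ)..s, D σ τ := by
      refine intervalIntegral.integral_congr fun τ hτ => ?_
      rw [Set.uIcc_of_le ht.1] at hτ
      have hτ' : τ ∈ Set.Icc (0:ℝ) 1 := ⟨hτ.1, hτ.2.trans ht.2⟩
      exact (ftc (hDs τ) (fun z hz => hBD z hz τ hτ') s hs).symm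
    rw [intervalIntegral.integral_sub ((hBt s).intervalIntegrable _ _)
      ((hBt 0).intervalIntegrable _ _), h1, h2] at h3
    have h4 : ∫ τ in (0:ℝ)..t, ∫ σ in (0:ℝ)..s, D σ τ
        = ∫ σ in (0:ℝ)..s, ∫ τ in (0:ℝ)..t, D σ τ := by
      rw [intervalIntegral.integral_of_le ht.1, intervalIntegral.integral_of_le hs.1]
      simp only [intervalIntegral.integral_of_le ht.1, intervalIntegral.integral_of_le hs.1]
      refine integral_integral_swap (f := fun τ σ => D σ τ) ?_
      rw [Measure.prod_restrict]
      exact ((hD.comp continuous_swap).continuousOn.integrableOn_compact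
        (isCompact_Icc.prod isCompact_Icc)).mono_set
        (Set.prod_mono Set.Ioc_subset_Icc_self Set.Ioc_subset_Icc_self)
    linarith
  have hC : ∀ t ∈ Set.Icc (0:ℝ) 1, C s t = C s 0 + ∫ τ in (0:ℝ)..t, D s τ := by
    intro t ht
    have h1 : HasDerivWithinAt
        (fun s => A s 0 + (A 0 t - A 0 0) + ∫ σ in (0:ℝ)..s, ∫ τ in (0:ℝ)..t, D σ τ)
        (C s 0 + ∫ τ in (0:ℝ)..t, D s τ) (Set.Icc 0 1) s :=
      ((hAC s hs 0 zero_mem).add_const _).add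
        ((hcont t).integral_hasStrictDerivAt 0 s).hasDerivAt.hasDerivWithinAt
    have h2 := h1.congr (fun s hs => hA s hs t ht) (hA s hs t ht)
    exact (uniqueDiffOn_Icc zero_lt_one s hs).eq_deriv _ (hAC s hs t ht) h2
  exact (((hDt s).integral_hasStrictDerivAt 0 t).hasDerivAt.hasDerivWithinAt.const_add
    (C s 0)).congr hC (hC t ht)

theorem exists_uniform_close {C : ℝ → ℝ → ℝ} (hC : Continuous (Function.uncurry C))
    {s : ℝ} (hs : s ∈ Set.Icc (0:ℝ) 1) {ε : ℝ} (hε : 0 < ε) :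
    ∃ δ > 0, ∀ σ ∈ Set.Icc (0:ℝ) 1, |σ - s| < δ → ∀ t ∈ Set.Icc (0:ℝ) 1,
      |C σ t - C s t| ≤ ε := by
  have hu := (isCompact_Icc (a := (0:ℝ)) (b := 1)).prod
    (isCompact_Icc (a := (0:ℝ)) (b := 1)) |>.uniformContinuousOn_of_continuous hC.continuousOn
  rw [Metric.uniformContinuousOn_iff] at hu
  obtain ⟨δ, hδ, h⟩ := hu ε hε
  refine ⟨δ, hδ, fun σ hσ hd t ht => ?_⟩
  have := h (σ, t) ⟨hσ, ht⟩ (s, t) ⟨hs, ht⟩ (by simpa [Prod.dist_eq, Real.dist_eq] using hd)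
  simpa [Real.dist_eq] using this.le

/-- First-order Taylor remainder on an interval where the derivative is nearly constant. -/
theorem abs_sub_sub_mul_le {g g' : ℝ → ℝ} {s δ ε : ℝ} (hs : s ∈ Set.Icc (0:ℝ) 1)
    (hd : ∀ z ∈ Set.Icc (0:ℝ) 1, HasDerivWithinAt g (g' z) (Set.Icc 0 1) z)
    (hg' : ∀ σ ∈ Set.Icc (0:ℝ) 1, |σ - s| < δ → |g' σ - g' s| ≤ ε)
    {σ : ℝ} (hσ : σ ∈ Set.Icc (0:ℝ) 1) (hσs : |σ - s| < δ) :
    |g σ - g s - (σ - s) * g' s| ≤ ε * |σ - s| := by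
  have hconv : Convex ℝ (Set.Icc (0:ℝ) 1 ∩ Metric.ball s δ) :=
    (convex_Icc 0 1).inter (convex_ball s δ)
  have hδ : 0 < δ := (abs_nonneg _).trans_lt hσs
  have h := hconv.norm_image_sub_le_of_norm_hasDerivWithin_le
    (f := fun z => g z - z * g' s) (f' := fun z => g' z - 1 * g' s) (C := ε)
    (fun z hz => ((hd z hz.1).mono Set.inter_subset_left).sub
      ((hasDerivWithinAt_id z _).mul_const (g' s)))
    (fun z hz => by simpa using hg' z hz.1 (by simpa [Real.dist_eq] using hz.2))
    (x := s) (y := σ) ⟨hs, Metric.mem_ball_self hδ⟩ ⟨hσ, by simpa [Real.dist_eq] using hσs⟩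
  rw [Real.norm_eq_abs, Real.norm_eq_abs] at h
  convert h using 2
  ring

/-- The mixed derivative bound for two kernels on the unit square. -/
theorem abs_mixed_derivWithin_le {p q : ℝ → Measure ℝ} [∀ z, IsProbabilityMeasure (p z)]
    [∀ z, IsProbabilityMeasure (q z)] (hp : ContractsC1 p) (hq : ContractsC1 q)
    (hps : ∀ z, ∀ᵐ y ∂ p z, y ∈ Set.Icc (0:ℝ) 1)
    {A B C D : ℝ → ℝ → ℝ} {M : ℝ}
    (hA : Continuous (Function.uncurry A)) (hB : Continuous (Function.uncurry B))
    (hC : Continuous (Function.uncurry C)) (hD : Continuous (Function.uncurry D))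
    (hAM : ∀ s t, |A s t| ≤ M) (hBM : ∀ s t, |B s t| ≤ M)
    (hCM : ∀ s t, |C s t| ≤ M) (hDM : ∀ s t, |D s t| ≤ M)
    (hAB : ∀ s ∈ Set.Icc (0:ℝ) 1, ∀ t ∈ Set.Icc (0:ℝ) 1,
      HasDerivWithinAt (A s) (B s t) (Set.Icc 0 1) t)
    (hAC : ∀ s ∈ Set.Icc (0:ℝ) 1, ∀ t ∈ Set.Icc (0:ℝ) 1,
      HasDerivWithinAt (fun s => A s t) (C s t) (Set.Icc 0 1) s)
    (hBD : ∀ s ∈ Set.Icc (0:ℝ) 1, ∀ t ∈ Set.Icc (0:ℝ) 1,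
      HasDerivWithinAt (fun s => B s t) (D s t) (Set.Icc 0 1) s)
    {a b : ℝ} (ha : a ∈ Set.Icc (0:ℝ) 1) (hb : b ∈ Set.Icc (0:ℝ) 1) :
    |derivWithin (fun a => derivWithin (fun b => ∫ s, ∫ t, A s t ∂ q b ∂ p a)
      (Set.Icc 0 1) b) (Set.Icc 0 1) a| ≤ M := by
  have hCD : ∀ s ∈ Set.Icc (0:ℝ) 1, ∀ t ∈ Set.Icc (0:ℝ) 1,
      HasDerivWithinAt (C s) (D s t) (Set.Icc 0 1) t := fun s hs t ht =>
    hasDerivWithinAt_of_mixed hB hD hAB hAC hBD hs ht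
  have hBt : ∀ s, ContinuousOn (B s) (Set.Icc 0 1) := fun s =>
    (hB.comp (Continuous.prodMk_right s)).continuousOn
  have hDt : ∀ s, ContinuousOn (D s) (Set.Icc 0 1) := fun s =>
    (hD.comp (Continuous.prodMk_right s)).continuousOn
  have hAi : ∀ s z, Integrable (A s) (q z) := fun s z =>
    Integrable.of_bound (hA.comp (Continuous.prodMk_right s)).aestronglyMeasurable M
      (ae_of_all _ (hAM s))
  have hCi : ∀ s z, Integrable (C s) (q z) := fun s z =>
    Integrable.of_bound (hC.comp (Continuous.prodMk_right s)).aestronglyMeasurable M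
      (ae_of_all _ (hCM s))
  have hu : UniqueDiffWithinAt ℝ (Set.Icc (0:ℝ) 1) b := uniqueDiffOn_Icc zero_lt_one b hb
  set L : (ℝ → ℝ) → ℝ := fun ψ => derivWithin (fun z => ∫ y, ψ y ∂ q z) (Set.Icc 0 1) b
  have hLA : ∀ s ∈ Set.Icc (0:ℝ) 1,
      HasDerivWithinAt (fun z => ∫ y, A s y ∂ q z) (L (A s)) (Set.Icc 0 1) b := fun s hs =>
    (hq _ _ M (hBt s) (hAB s hs) (fun t _ => hAM s t) (fun t _ => hBM s t) b hb).1.hasDerivWithinAt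
  have hLC : ∀ s ∈ Set.Icc (0:ℝ) 1,
      HasDerivWithinAt (fun z => ∫ y, C s y ∂ q z) (L (C s)) (Set.Icc 0 1) b := fun s hs =>
    (hq _ _ M (hDt s) (hCD s hs) (fun t _ => hCM s t) (fun t _ => hDM s t) b hb).1.hasDerivWithinAt
  have inner : ∀ a, HasDerivWithinAt (fun b => ∫ s, ∫ t, A s t ∂ q b ∂ p a)
      (∫ s, L (A s) ∂ p a) (Set.Icc 0 1) b := by
    intro a
    refine hasDerivWithinAt_integral_of_lipschitz (M := M) hb (fun z _ => ?_) ?_ ?_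
    · refine Integrable.of_bound (C := M) (Continuous.aestronglyMeasurable ?_)
        (ae_of_all _ fun s => ?_)
      · exact continuous_of_dominated (bound := fun _ => M)
          (fun s => (hAi s z).aestronglyMeasurable) (fun s => ae_of_all _ (hAM s))
          (integrable_const M) (ae_of_all _ fun t => hA.comp (Continuous.prodMk_left t))
      · simpa using norm_integral_le_of_norm_le_const (μ := q z) (f := A s) (C := M)
          (ae_of_all _ (hAM s))
    · filter_upwards [hps a] with s hs z hz
      have hK := hq _ _ M (hBt s) (hAB s hs) (fun t _ => hAM s t) (fun t _ => hBM s t)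
      exact (convex_Icc (0:ℝ) 1).norm_image_sub_le_of_norm_derivWithin_le
        (fun z hz => (hK z hz).1) (fun z hz => (hK z hz).2) hb hz
    · filter_upwards [hps a] with s hs using hLA s hs
  have outer : (fun a => derivWithin (fun b => ∫ s, ∫ t, A s t ∂ q b ∂ p a) (Set.Icc 0 1) b)
      = fun a => ∫ s, L (A s) ∂ p a := funext fun a => (inner a).derivWithin hu
  rw [outer]
  refine (hp (fun s => L (A s)) (fun s => L (C s)) M ?_ ?_ ?_ ?_ a ha).2
  · intro s hs
    rw [Metric.continuousWithinAt_iff]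
    intro ε hε
    obtain ⟨δ₁, hδ₁, h₁⟩ := exists_uniform_close hC hs (half_pos hε)
    obtain ⟨δ₂, hδ₂, h₂⟩ := exists_uniform_close hD hs (half_pos hε)
    refine ⟨min δ₁ δ₂, lt_min hδ₁ hδ₂, fun {σ} hσ hd => ?_⟩
    rw [Real.dist_eq, lt_min_iff] at hd
    have hK := (hq (fun t => C σ t - C s t) (fun t => D σ t - D s t) (ε / 2)
      ((hDt σ).sub (hDt s)) (fun t ht => (hCD σ hσ t ht).sub (hCD s hs t ht))
      (h₁ σ hσ hd.1) (h₂ σ hσ hd.2) b hb).2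
    have heq : (fun z => ∫ t, (C σ t - C s t) ∂ q z)
        = (fun z => ∫ t, C σ t ∂ q z) - fun z => ∫ t, C s t ∂ q z :=
      funext fun z => integral_sub (hCi σ z) (hCi s z)
    rw [heq, ((hLC σ hσ).sub (hLC s hs)).derivWithin hu] at hK
    rw [Real.dist_eq]
    linarith
  · intro s hs
    rw [hasDerivWithinAt_iff_isLittleO, Asymptotics.isLittleO_iff]
    intro ε hε
    obtain ⟨δ₁, hδ₁, h₁⟩ := exists_uniform_close hC hs hε
    obtain ⟨δ₂, hδ₂, h₂⟩ := exists_uniform_close hD hs hε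
    filter_upwards [self_mem_nhdsWithin,
      mem_nhdsWithin_of_mem_nhds (Metric.ball_mem_nhds s (lt_min hδ₁ hδ₂))] with σ hσ hd
    rw [Metric.mem_ball, Real.dist_eq, lt_min_iff] at hd
    have hK := (hq (fun t => A σ t - A s t - (σ - s) * C s t)
      (fun t => B σ t - B s t - (σ - s) * D s t) (ε * |σ - s|)
      (((hBt σ).sub (hBt s)).sub ((hDt s).const_mul _))
      (fun t ht => ((hAB σ hσ t ht).sub (hAB s hs t ht)).sub ((hCD s hs t ht).const_mul _))
      (fun t ht => abs_sub_sub_mul_le hs (fun z hz => hAC z hz t ht)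
        (fun σ hσ hd => h₁ σ hσ hd t ht) hσ hd.1)
      (fun t ht => abs_sub_sub_mul_le hs (fun z hz => hBD z hz t ht)
        (fun σ hσ hd => h₂ σ hσ hd t ht) hσ hd.2) b hb).2
    have heq : (fun z => ∫ t, (A σ t - A s t - (σ - s) * C s t) ∂ q z)
        = ((fun z => ∫ t, A σ t ∂ q z) - fun z => ∫ t, A s t ∂ q z)
          - fun z => (σ - s) * ∫ t, C s t ∂ q z := by
      funext z
      have h : Integrable (fun t => A σ t - A s t) (q z) := (hAi σ z).sub (hAi s z)
      rw [integral_sub h ((hCi s z).const_mul _), integral_sub (hAi σ z) (hAi s z),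
        integral_const_mul]
      rfl
    rw [heq, (((hLA σ hσ).sub (hLA s hs)).sub ((hLC s hs).const_mul (σ - s))).derivWithin hu] at hK
    simpa using hK
  · exact fun s hs => (hq _ _ M (hBt s) (hAB s hs) (fun t _ => hAM s t)
      (fun t _ => hBM s t) b hb).2
  · exact fun s hs => (hq _ _ M (hDt s) (hCD s hs) (fun t _ => hCM s t)
      (fun t _ => hDM s t) b hb).2

theorem map_update_prod_pi {ι : Type*} [Fintype ι] [DecidableEq ι] (μ : ι → Measure ℝ)
    [∀ k, IsProbabilityMeasure (μ k)] (i : ι) (ν : Measure ℝ) [IsProbabilityMeasure ν] :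
    (ν.prod (Measure.pi μ)).map (fun q => Function.update q.2 i q.1)
      = Measure.pi (Function.update μ i ν) := by
  have : ∀ k, IsProbabilityMeasure (Function.update μ i ν k) := fun k => by
    rcases eq_or_ne k i with rfl | h
    · rwa [Function.update_self]
    · rw [Function.update_of_ne h]; infer_instance
  have hmeas : Measurable fun q : ℝ × (ι → ℝ) => Function.update q.2 i q.1 := by
    refine Continuous.measurable ?_
    fun_prop
  refine (Measure.pi_eq fun S hS => ?_).symm
  have hpre : (fun q : ℝ × (ι → ℝ) => Function.update q.2 i q.1) ⁻¹' Set.univ.pi S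
      = S i ×ˢ Set.univ.pi (Function.update S i Set.univ) := by
    ext ⟨s, y⟩
    simp only [Set.mem_preimage, Set.mem_univ_pi, Set.mem_prod]
    constructor
    · intro h
      refine ⟨by simpa using h i, fun k => ?_⟩
      rcases eq_or_ne k i with rfl | hk
      · simp
      · simpa [hk] using h k
    · rintro ⟨h0, h⟩ k
      rcases eq_or_ne k i with rfl | hk
      · simpa using h0
      · simpa [hk] using h k
  rw [Measure.map_apply hmeas (MeasurableSet.univ_pi hS), hpre, Measure.prod_prod, Measure.pi_pi,
    ← Finset.mul_prod_erase Finset.univ _ (Finset.mem_univ i),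
    ← Finset.mul_prod_erase Finset.univ (fun k => Function.update μ i ν k (S k))
      (Finset.mem_univ i)]
  simp only [Function.update_self, measure_univ, one_mul]
  congr 1
  refine Finset.prod_congr rfl fun k hk => ?_
  simp [Finset.ne_of_mem_erase hk]

theorem integral_pi_update {ι : Type*} [Fintype ι] [DecidableEq ι] (μ : ι → Measure ℝ)
    [∀ k, IsProbabilityMeasure (μ k)] (i : ι) (ν : Measure ℝ) [IsProbabilityMeasure ν]
    {g : (ι → ℝ) → ℝ} (hg : Continuous g) {M : ℝ} (hM : ∀ y, |g y| ≤ M) :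
    ∫ y, g y ∂ Measure.pi (Function.update μ i ν)
      = ∫ s, ∫ y, g (Function.update y i s) ∂ Measure.pi μ ∂ ν := by
  have hcont : Continuous fun q : ℝ × (ι → ℝ) => Function.update q.2 i q.1 := by fun_prop
  rw [← map_update_prod_pi, integral_map hcont.aemeasurable hg.aestronglyMeasurable]
  exact integral_prod _ (Integrable.of_bound (hg.comp hcont).aestronglyMeasurable M
    (ae_of_all _ fun _ => hM _))

/-- Coordinatewise projection onto the unit cube. -/
def clampCube (d : ℕ) (y : Fin d → ℝ) : Fin d → ℝ :=
  fun k => Set.projIcc (0:ℝ) 1 zero_le_one (y k)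

theorem clampCube_mem (d : ℕ) (y : Fin d → ℝ) : clampCube d y ∈ cube d :=
  fun k _ => (Set.projIcc (0:ℝ) 1 zero_le_one (y k)).2

theorem clampCube_of_mem {d : ℕ} {y : Fin d → ℝ} (hy : y ∈ cube d) : clampCube d y = y :=
  funext fun k => congrArg Subtype.val (Set.projIcc_of_mem zero_le_one (hy k trivial))

theorem continuous_clampCube (d : ℕ) : Continuous (clampCube d) :=
  continuous_pi fun k => continuous_subtype_val.comp
    (continuous_projIcc.comp (continuous_apply k))

theorem clampCube_update {d : ℕ} (y : Fin d → ℝ) (i : Fin d) {t : ℝ}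
    (ht : t ∈ Set.Icc (0:ℝ) 1) :
    clampCube d (Function.update y i t) = Function.update (clampCube d y) i t := by
  funext k
  rcases eq_or_ne k i with rfl | hk
  · simp [clampCube, Set.projIcc_of_mem zero_le_one ht]
  · simp [clampCube, hk]

theorem continuous_comp_clampCube {d : ℕ} {f : (Fin d → ℝ) → ℝ} (hf : ContinuousOn f (cube d)) :
    Continuous fun y => f (clampCube d y) :=
  hf.comp_continuous (continuous_clampCube d) (clampCube_mem d)

theorem hasDerivWithinAt_comp_clampCube {d : ℕ} {f : (Fin d → ℝ) → ℝ} {i : Fin d}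
    (hf : ∀ x ∈ cube d, DifferentiableWithinAt ℝ (fun t => f (Function.update x i t))
      (Set.Icc (0:ℝ) 1) (x i)) (y : Fin d → ℝ) {s : ℝ} (hs : s ∈ Set.Icc (0:ℝ) 1) :
    HasDerivWithinAt (fun t => f (clampCube d (Function.update y i t)))
      (pd d i f (clampCube d (Function.update y i s))) (Set.Icc 0 1) s := by
  have h := (hf _ (clampCube_mem d (Function.update y i s))).hasDerivWithinAt
  rw [clampCube_update y i hs] at h ⊢
  simp only [Function.update_idem, Function.update_self] at h
  simp only [pd, Function.update_idem, Function.update_self]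
  exact h.congr (fun t ht => by rw [clampCube_update y i ht])
    (by rw [clampCube_update y i hs])

theorem hasDerivWithinAt_integral_comp_clampCube {d : ℕ} {Ω : Type*} [MeasurableSpace Ω]
    [TopologicalSpace Ω] [OpensMeasurableSpace Ω]
    {μ : Measure Ω} [IsFiniteMeasure μ] {f : (Fin d → ℝ) → ℝ} {i : Fin d} {M : ℝ}
    (hc : ContinuousOn f (cube d))
    (hf : ∀ x ∈ cube d, DifferentiableWithinAt ℝ (fun t => f (Function.update x i t))
      (Set.Icc (0:ℝ) 1) (x i)) (hM : ∀ x ∈ cube d, |f x| ≤ M)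
    (hM' : ∀ x ∈ cube d, |pd d i f x| ≤ M)
    {Y : Ω → Fin d → ℝ} (hY : Continuous Y) {s : ℝ} (hs : s ∈ Set.Icc (0:ℝ) 1) :
    HasDerivWithinAt (fun t => ∫ ω, f (clampCube d (Function.update (Y ω) i t)) ∂μ)
      (∫ ω, pd d i f (clampCube d (Function.update (Y ω) i s)) ∂μ) (Set.Icc 0 1) s := by
  refine hasDerivWithinAt_integral_of_lipschitz (M := M) hs (fun z _ => ?_)
    (ae_of_all _ fun ω z hz => ?_)
    (ae_of_all _ fun ω => hasDerivWithinAt_comp_clampCube hf (Y ω) hs)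
  · exact Integrable.of_bound ((continuous_comp_clampCube hc).comp
      (hY.update i continuous_const)).aestronglyMeasurable M
      (ae_of_all _ fun ω => hM _ (clampCube_mem d _))
  · exact (convex_Icc (0:ℝ) 1).norm_image_sub_le_of_norm_hasDerivWithin_le
      (fun z hz => hasDerivWithinAt_comp_clampCube hf (Y ω) hz)
      (fun z _ => hM' _ (clampCube_mem d _)) hs hz

theorem abs_le_supCube {d : ℕ} {g : (Fin d → ℝ) → ℝ} (hg : ContinuousOn g (cube d))
    {x : Fin d → ℝ} (hx : x ∈ cube d) : |g x| ≤ supCube d g := by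
  have hcomp : IsCompact (cube d) := isCompact_univ_pi fun _ => isCompact_Icc
  have h := hcomp.bddAbove_image hg.abs
  rw [Set.image_eq_range] at h
  exact le_ciSup h ⟨x, hx⟩

theorem continuous_integral_comp_clampCube {d : ℕ} (μ : Measure (Fin d → ℝ)) [IsFiniteMeasure μ]
    {g : (Fin d → ℝ) → ℝ} (hg : ContinuousOn g (cube d)) {M : ℝ} (hM : ∀ x ∈ cube d, |g x| ≤ M)
    (i j : Fin d) :
    Continuous (Function.uncurry fun s t =>
      ∫ y, g (clampCube d (Function.update (Function.update y j t) i s)) ∂μ) := by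
  have hc := continuous_comp_clampCube hg
  refine continuous_of_dominated (bound := fun _ => M)
    (fun q => (hc.comp ?_).aestronglyMeasurable)
    (fun q => ae_of_all _ fun y => hM _ (clampCube_mem d _)) (integrable_const M)
    (ae_of_all _ fun y => hc.comp ?_) <;> fun_prop

/-- Pointwise bound on mixed second partial derivatives of the product-kernel operator
(for `i ≠ j`): `|(∂²/∂x_i∂x_j)(T²f)(x)| ≤ max_{k,l ∈ {0,1}} ‖∂^{k+l} f/(∂x_i^k ∂x_j^l)‖_∞`,
where each kernel is a `C^{m'}`-contraction for `m' ∈ {0,1}` and bounded by `c` on `C²`. -/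
theorem mixed_second_derivative_bound_product_kernel
    (d : ℕ) (hd : 2 ≤ d) (c : ℝ) (hc : 1 ≤ c)
    (p : Fin d → ℝ → Measure ℝ)
    [∀ k z, IsProbabilityMeasure (p k z)]
    (hmeas : ∀ k : Fin d, Measurable (p k))
    (hsupp : ∀ k : Fin d, ∀ z, p k z (Set.Icc (0:ℝ) 1)ᶜ = 0)
    (hp : ∀ k : Fin d, ∀ m' ≤ 2, ∀ φ : ℝ → ℝ, MemC1d m' φ →
      MemC1d m' (fun z => ∫ y, φ y ∂ p k z) ∧
      (m' ≤ 1 → C1dNorm m' (fun z => ∫ y, φ y ∂ p k z) ≤ C1dNorm m' φ) ∧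
      (m' = 2 → C1dNorm m' (fun z => ∫ y, φ y ∂ p k z) ≤ c * C1dNorm m' φ))
    (f : (Fin d → ℝ) → ℝ) (hf : MemCm d 2 f) (i j : Fin d) (hij : i ≠ j)
    (x : Fin d → ℝ) (hx : x ∈ cube d) :
    |pd d i (pd d j (fun x' : Fin d → ℝ => ∫ y, f y ∂ Measure.pi (fun k => p k (x' k)))) x| ≤
      ⨆ k : Fin 2, ⨆ l : Fin 2, supCube d ((pd d i)^[(k : ℕ)] ((pd d j)^[(l : ℕ)] f)) := by
  set M := ⨆ k : Fin 2, ⨆ l : Fin 2, supCube d ((pd d i)^[(k : ℕ)] ((pd d j)^[(l : ℕ)] f))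
  have hsup : ∀ k l : Fin 2, supCube d ((pd d i)^[(k : ℕ)] ((pd d j)^[(l : ℕ)] f)) ≤ M :=
    fun k l => (le_ciSup (f := fun l : Fin 2 =>
        supCube d ((pd d i)^[(k : ℕ)] ((pd d j)^[(l : ℕ)] f))) (Set.finite_range _).bddAbove l).trans
      (le_ciSup (f := fun k : Fin 2 => ⨆ l : Fin 2,
        supCube d ((pd d i)^[(k : ℕ)] ((pd d j)^[(l : ℕ)] f))) (Set.finite_range _).bddAbove k)
  obtain ⟨hf0, hf1⟩ := hf
  obtain ⟨hfi, hfi0, -⟩ := hf1 i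
  obtain ⟨hfj, hfj0, hfj1⟩ := hf1 j
  obtain ⟨hfij, hfij0⟩ := hfj1 i
  have hAM : ∀ y ∈ cube d, |f y| ≤ M := fun y hy => (abs_le_supCube hf0 hy).trans (hsup 0 0)
  have hBM : ∀ y ∈ cube d, |pd d j f y| ≤ M := fun y hy =>
    (abs_le_supCube hfj0 hy).trans (hsup 0 1)
  have hCM : ∀ y ∈ cube d, |pd d i f y| ≤ M := fun y hy =>
    (abs_le_supCube hfi0 hy).trans (hsup 1 0)
  have hDM : ∀ y ∈ cube d, |pd d i (pd d j f) y| ≤ M := fun y hy =>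
    (abs_le_supCube hfij0 hy).trans (hsup 1 1)
  set μ : Measure (Fin d → ℝ) := Measure.pi fun k => p k (x k)
  have hK : ∀ k, ContractsC1 (p k) := fun k => contractsC1_of_C1dNorm_le fun φ hφ =>
    ⟨(hp k 1 one_le_two φ hφ).1, (hp k 1 one_le_two φ hφ).2.1 le_rfl⟩
  have hps : ∀ k z, ∀ᵐ y ∂ p k z, y ∈ Set.Icc (0:ℝ) 1 := fun k z => hsupp k z
  have hT : ∀ a b, ∫ y, f y ∂ Measure.pi
        (fun k => p k (Function.update (Function.update x i a) j b k))
      = ∫ s, ∫ t, ∫ y, f (clampCube d (Function.update (Function.update y j t) i s)) ∂μ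
          ∂ p j b ∂ p i a := by
    intro a b
    have h1 : ∫ y, f y ∂ Measure.pi (fun k => p k (Function.update (Function.update x i a) j b k))
        = ∫ y, f (clampCube d y) ∂ Measure.pi
          (fun k => p k (Function.update (Function.update x i a) j b k)) := by
      refine integral_congr_ae ?_
      have : ∀ᵐ y ∂ Measure.pi (fun k => p k (Function.update (Function.update x i a) j b k)),
          ∀ k, y k ∈ Set.Icc (0:ℝ) 1 := ae_all_iff.2 fun k =>
        (measurePreserving_eval _ k).quasiMeasurePreserving.ae (hps k _)
      filter_upwards [this] with y hy
      rw [clampCube_of_mem fun k _ => hy k]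
    have h2 : (fun k => p k (Function.update (Function.update x i a) j b k))
        = Function.update (Function.update (fun k => p k (x k)) j (p j b)) i (p i a) := by
      funext k
      rcases eq_or_ne k i with rfl | hki
      · simp [hij]
      · rcases eq_or_ne k j with rfl | hkj
        · simp [hki]
        · simp [hki, hkj]
    have : ∀ k, IsProbabilityMeasure
        (Function.update (fun k => p k (x k)) j (p j b) k) := fun k => by
      rcases eq_or_ne k j with rfl | h
      · rw [Function.update_self]; infer_instance
      · rw [Function.update_of_ne h]; infer_instance
    have hcl := continuous_comp_clampCube hf0
    rw [h1, h2, integral_pi_update _ i _ hcl fun y => hAM _ (clampCube_mem d y)]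
    refine integral_congr_ae (ae_of_all _ fun s => ?_)
    exact integral_pi_update _ j _
      (g := fun y => f (clampCube d (Function.update y i s)))
      (hcl.comp (continuous_id.update i continuous_const)) fun y => hAM _ (clampCube_mem d _)
  have hbound : ∀ {g : (Fin d → ℝ) → ℝ}, (∀ y ∈ cube d, |g y| ≤ M) → ∀ s t,
      |∫ y, g (clampCube d (Function.update (Function.update y j t) i s)) ∂μ| ≤ M := by
    intro g hg s t
    simpa using norm_integral_le_of_norm_le_const (μ := μ)
      (f := fun y => g (clampCube d (Function.update (Function.update y j t) i s)))
      (ae_of_all _ fun y => hg _ (clampCube_mem d _))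
  have hcomm : ∀ (y : Fin d → ℝ) s t, Function.update (Function.update y j t) i s
      = Function.update (Function.update y i s) j t := fun y s t =>
    Function.update_comm hij.symm _ _ _
  have hi : x i ∈ Set.Icc (0:ℝ) 1 := hx i trivial
  have hj : x j ∈ Set.Icc (0:ℝ) 1 := hx j trivial
  have hmain := abs_mixed_derivWithin_le (hK i) (hK j) (hps i)
    (continuous_integral_comp_clampCube μ hf0 hAM i j)
    (continuous_integral_comp_clampCube μ hfj0 hBM i j)
    (continuous_integral_comp_clampCube μ hfi0 hCM i j)
    (continuous_integral_comp_clampCube μ hfij0 hDM i j)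
    (hbound hAM) (hbound hBM) (hbound hCM) (hbound hDM)
    (fun s hs t ht => by
      simp only [hcomm]
      exact hasDerivWithinAt_integral_comp_clampCube hf0 hfj hAM hBM
        (continuous_id.update i continuous_const) ht)
    (fun s hs t ht => hasDerivWithinAt_integral_comp_clampCube hf0 hfi hAM hCM
        (continuous_id.update j continuous_const) hs)
    (fun s hs t ht => hasDerivWithinAt_integral_comp_clampCube hfj0 hfij hBM hDM
        (continuous_id.update j continuous_const) hs) hi hj
  simp only [← hT] at hmain
  simpa only [pd, Function.update_of_ne hij.symm] using hmain

end
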